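/- Let P be a pircon, w ∈ P non-minimal, and M, N ∈ SPM_w two strictly coherent special partial matchings of w; let m be the rank of the orbit ⟨M,N⟩(w), fix x ∈ {q,−1}, let O be any orbit of ⟨M,N⟩ on P_{≤w}, and let 𝔐^O be the free ℤ[q^{1/2},q^{−1/2}]-module with basis {m_u : u ∈ O}. Define endomorphisms T_M and T_N of 𝔐^O by T_M(m_u) = m_{M(u)} if M(u) is covered by u, T_M(m_u) = q·m_{M(u)} + (q−1)·m_u if M(u) covers u, T_M(m_u) = x·m_u if M(u) = u, and analogously for T_N. Then T_M ∘ T_M = (q−1)·T_M + q·id, T_N ∘ T_N = (q−1)·T_N + q·id, and the alternating composition ⋯ T_M ∘ T_N ∘ T_M with m factors equals the alternating composition ⋯ T_N ∘ T_M ∘ T_N with m factors; hence 𝔐^O is a module over the Hecke algebra of the dihedral Coxeter group with m(M,N) = m, with T_M and T_N giving the actions of the two generators. -/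

import Mathlib

attribute [local instance] Classical.propDecidable

noncomputable section

/-- A special partial matching of the order ideal `P_{≤ w}`, encoded as a total function
`M : P → P` whose values outside `Set.Iic w` are irrelevant. -/
def IsSPMof {P : Type*} [PartialOrder P] (w : P) (M : P → P) : Prop :=
  (∀ x, x ≤ w → M x ≤ w) ∧ (∀ x, x ≤ w → M (M x) = x) ∧ M w ⋖ w ∧
  (∀ x, x ≤ w → (M x ⋖ x ∨ M x = x ∨ x ⋖ M x)) ∧
  (∀ x y, x ≤ w → y ≤ w → x ⋖ y → M x ≠ y → M x < M y)

/-- A poset is a pircon if, for every non-minimal element `w`, the order ideal `P_{≤ w}`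
is finite and admits a special partial matching. -/
def IsPircon (P : Type*) [PartialOrder P] : Prop :=
  ∀ w : P, ¬ IsMin w → (Set.Iic w).Finite ∧ ∃ M : P → P, IsSPMof w M

/-- The orbit of `u` under the group of permutations generated by `M` and `N`. -/
def orbitMN {P : Type*} (M N : P → P) (u : P) : Set P :=
  {v | Relation.ReflTransGen (fun a b => M a = b ∨ N a = b) u v}

/-- `a` is covered by `b` inside the subposet induced on the set `O`. -/
def CovIn {P : Type*} [PartialOrder P] (O : Set P) (a b : P) : Prop :=
  a ∈ O ∧ b ∈ O ∧ a < b ∧ ∀ c ∈ O, ¬ (a < c ∧ c < b)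

/-- The set `O`, with the induced order, is a dihedral interval of rank `n`. -/
def IsDihedralIntervalOfRank {P : Type*} [PartialOrder P] (O : Set P) (n : ℕ) : Prop :=
  O.Finite ∧ ∃ ρ : P → ℕ,
    (∃ b ∈ O, (∀ z ∈ O, b ≤ z) ∧ ρ b = 0) ∧
    (∃ t ∈ O, (∀ z ∈ O, z ≤ t) ∧ ρ t = n) ∧
    (∀ a b, CovIn O a b → ρ b = ρ a + 1) ∧
    (∀ i, 0 < i → i < n → {z ∈ O | ρ z = i}.ncard = 2) ∧
    (∀ a ∈ O, ∀ b ∈ O, ρ a < ρ b → a < b)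

/-- Two special partial matchings `M, N` of `w` are strictly coherent: for every orbit
of `⟨M,N⟩` on `P_{≤ w}`, its rank divides the rank `m` of `⟨M,N⟩(w)` if the orbit is a
dihedral interval, and its rank plus one (= its cardinality, for a finite chain)
divides `m` if the orbit is totally ordered. -/
def StrictlyCoherent {P : Type*} [PartialOrder P] (M N : P → P) (w : P) : Prop :=
  ∀ m : ℕ, IsDihedralIntervalOfRank (orbitMN M N w) m →
    ∀ u, u ≤ w →
      (∀ n : ℕ, IsDihedralIntervalOfRank (orbitMN M N u) n → n ∣ m) ∧
      ((∀ a ∈ orbitMN M N u, ∀ b ∈ orbitMN M N u, a ≤ b ∨ b ≤ a) →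
        (orbitMN M N u).ncard ∣ m)

/-- The ring `ℤ[q^{1/2}, q^{-1/2}]`. -/
abbrev Rq : Type := LaurentPolynomial ℤ

/-- The element `q`. -/
def qq : Rq := LaurentPolynomial.T 2

/-- The free module `𝔐^O` on the orbit `O = ⟨M,N⟩(u0)`. -/
abbrev OrbMod {P : Type*} (M N : P → P) (u0 : P) : Type _ := ↥(orbitMN M N u0) →₀ Rq

/-- Value of `T_M` on the basis vector `m_v`. -/
def TMB {P : Type*} [PartialOrder P] (M N : P → P) (u0 : P) (x : Rq)
    (v : ↥(orbitMN M N u0)) : OrbMod M N u0 :=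
  have hMv : M v.1 ∈ orbitMN M N u0 := Relation.ReflTransGen.tail v.2 (Or.inl rfl)
  if M v.1 = v.1 then x • Finsupp.single v 1
  else if M v.1 ⋖ v.1 then Finsupp.single ⟨M v.1, hMv⟩ 1
  else qq • Finsupp.single (⟨M v.1, hMv⟩ : ↥(orbitMN M N u0)) 1 + (qq - 1) • Finsupp.single v 1

/-- Value of `T_N` on the basis vector `m_v`. -/
def TNB {P : Type*} [PartialOrder P] (M N : P → P) (u0 : P) (x : Rq)
    (v : ↥(orbitMN M N u0)) : OrbMod M N u0 :=
  have hNv : N v.1 ∈ orbitMN M N u0 := Relation.ReflTransGen.tail v.2 (Or.inr rfl)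
  if N v.1 = v.1 then x • Finsupp.single v 1
  else if N v.1 ⋖ v.1 then Finsupp.single ⟨N v.1, hNv⟩ 1
  else qq • Finsupp.single (⟨N v.1, hNv⟩ : ↥(orbitMN M N u0)) 1 + (qq - 1) • Finsupp.single v 1

/-- The endomorphism `T_M` of `𝔐^O`. -/
def TM {P : Type*} [PartialOrder P] (M N : P → P) (u0 : P) (x : Rq) :
    Module.End Rq (OrbMod M N u0) :=
  Finsupp.linearCombination Rq (TMB M N u0 x)

/-- The endomorphism `T_N` of `𝔐^O`. -/
def TN {P : Type*} [PartialOrder P] (M N : P → P) (u0 : P) (x : Rq) :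
    Module.End Rq (OrbMod M N u0) :=
  Finsupp.linearCombination Rq (TNB M N u0 x)

/-- The alternating product `⋯ A * B * A` with `n` factors (rightmost factor `A`). -/
def altProd {E : Type*} [Monoid E] (A B : E) : ℕ → E
  | 0 => 1
  | n + 1 => altProd B A n * A

/-- The `i`-th term of the alternating sequence `f, g, f, …`. -/
def letter {α : Type*} (f g : α) : ℕ → α
  | 0 => f
  | i + 1 => letter g f i

theorem letter_cases {α : Type*} {p : α → Prop} {f g : α} (hf : p f) (hg : p g) (i : ℕ) :
    p (letter f g i) := by
  induction i generalizing f g with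
  | zero => exact hf
  | succ i ih => exact ih hg hf

theorem letter_pair {α : Type*} (f g : α) (i : ℕ) :
    letter f g i = f ∧ letter g f i = g ∨ letter f g i = g ∧ letter g f i = f := by
  induction i generalizing f g with
  | zero => exact Or.inl ⟨rfl, rfl⟩
  | succ i ih => exact (ih f g).symm.imp And.symm And.symm

/-! ### Alternating products -/

theorem altProd_succ_left {E : Type*} [Monoid E] (A B : E) (n : ℕ) :
    altProd A B (n + 1) = letter A B n * altProd A B n := by
  induction n generalizing A B with
  | zero => simp [altProd, letter]
  | succ n ih => rw [altProd, ih B A, mul_assoc]; rfl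

theorem altProd_add {E : Type*} [Monoid E] (A B : E) (k n : ℕ) :
    altProd A B (k + n) = altProd (letter A B n) (letter B A n) k * altProd A B n := by
  induction n generalizing A B with
  | zero => simp [altProd, letter]
  | succ n ih =>
    change altProd B A (k + n) * A = _
    rw [ih B A, mul_assoc]
    rfl

theorem altProd_comm_of_dvd {E : Type*} [Monoid E] {A B : E} {n m : ℕ}
    (h : altProd A B n = altProd B A n) (hnm : n ∣ m) : altProd A B m = altProd B A m := by
  obtain ⟨k, rfl⟩ := hnm
  induction k with
  | zero => rfl
  | succ k ih =>
    rw [mul_add, mul_one, altProd_add, altProd_add B A, h]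
    congr 1
    rcases letter_pair A B n with ⟨h1, h2⟩ | ⟨h1, h2⟩ <;> rw [h1, h2, ih]

theorem altProd_sub_mul {R E : Type*} [CommRing R] [Ring E] [Algebra R E] {A B : E} {c d : R}
    (hA : A * A = c • A + d • (1 : E)) (hB : B * B = c • B + d • (1 : E)) (n : ℕ) :
    (altProd A B (n + 1) - altProd B A (n + 1)) * A =
      (c • (1 : E) - letter B A n) * (altProd A B (n + 1) - altProd B A (n + 1)) := by
  have hX : letter B A n * letter B A n = c • letter B A n + d • (1 : E) :=
    letter_cases (p := fun X => X * X = c • X + d • (1 : E)) hB hA n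
  have e1 : letter B A n * altProd A B (n + 1) = altProd B A (n + 1) * A :=
    (altProd_succ_left A B (n + 1)).symm
  have e2 : letter B A n * altProd B A (n + 1) =
      c • altProd B A (n + 1) + d • altProd B A n := by
    rw [altProd_succ_left B A n, ← mul_assoc, hX, add_mul, smul_mul_assoc, smul_mul_assoc,
      one_mul]
  have e3 : altProd A B (n + 1) * A = c • altProd A B (n + 1) + d • altProd B A n := by
    rw [show altProd A B (n + 1) = altProd B A n * A from rfl, mul_assoc, hA, mul_add,
      mul_smul_comm, mul_smul_comm, mul_one]
  rw [sub_mul, e3, sub_mul, mul_sub, mul_sub, e1, e2, smul_mul_assoc, smul_mul_assoc, one_mul,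
    one_mul]
  abel

theorem altProd_apply_letter {R V : Type*} [CommRing R] [AddCommGroup V] [Module R V]
    {A B : Module.End R V} {c d : R}
    (hA : A * A = c • A + d • (1 : Module.End R V))
    (hB : B * B = c • B + d • (1 : Module.End R V)) {n : ℕ} {v : V}
    (h : altProd A B n v = altProd B A n v) :
    altProd A B n (A v) = altProd B A n (A v) ∧ altProd A B n (B v) = altProd B A n (B v) := by
  cases n with
  | zero => exact ⟨rfl, rfl⟩
  | succ n =>
    have h1 := LinearMap.congr_fun (altProd_sub_mul hA hB n) v
    have h2 := LinearMap.congr_fun (altProd_sub_mul hB hA n) v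
    simp only [Module.End.mul_apply, LinearMap.sub_apply, h, sub_self, map_zero] at h1 h2
    exact ⟨sub_eq_zero.mp h1, (sub_eq_zero.mp h2).symm⟩

/-! ### Pairs of graded matchings -/

/-- `f` restricts to an involution of `O` moving each element by at most one rank, and respecting
the relation `lt` on pairs of consecutive ranks that it does not match. -/
structure IsMatchingOn {P : Type*} (O : Set P) (lt : P → P → Prop) (r : P → ℤ) (f : P → P) :
    Prop where
  mem : ∀ z ∈ O, f z ∈ O
  invol : ∀ z ∈ O, f (f z) = z
  step : ∀ z ∈ O, (lt (f z) z ∧ r z = r (f z) + 1) ∨ f z = z ∨ (lt z (f z) ∧ r (f z) = r z + 1)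
  mono : ∀ x ∈ O, ∀ y ∈ O, lt x y → r y = r x + 1 → f x ≠ y → lt (f x) (f y)
  rank : ∀ x ∈ O, ∀ y ∈ O, lt x y → r x < r y

/-- The walk `v, f v, g (f v), …`. -/
def walk {P : Type*} (f g : P → P) (v : P) : ℕ → P
  | 0 => v
  | i + 1 => letter f g i (walk f g v i)

section Walk

variable {P : Type*} {O : Set P} {lt : P → P → Prop} {r : P → ℤ} {f g : P → P}

theorem IsMatchingOn.flip (hf : IsMatchingOn O lt r f) :
    IsMatchingOn O (fun a b => lt b a) (fun z => -r z) f where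
  mem := hf.mem
  invol := hf.invol
  step z hz := by
    rcases hf.step z hz with ⟨h1, h2⟩ | h | ⟨h1, h2⟩
    · exact Or.inr (Or.inr ⟨h1, by omega⟩)
    · exact Or.inr (Or.inl h)
    · exact Or.inl ⟨h1, by omega⟩
  mono x hx y hy hlt hr hne := by
    refine hf.mono y hy x hx hlt (by omega) fun h => hne ?_
    rw [← h, hf.invol y hy]
  rank x hx y hy h := by
    have := hf.rank y hy x hx h
    omega

theorem IsMatchingOn.lt_of_rank (hf : IsMatchingOn O lt r f) {z : P} (hz : z ∈ O)
    (h : r (f z) < r z) : lt (f z) z ∧ r z = r (f z) + 1 := by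
  rcases hf.step z hz with h1 | h1 | ⟨-, h1⟩
  · exact h1
  · rw [h1] at h; omega
  · omega

theorem walk_mem (hf : IsMatchingOn O lt r f) (hg : IsMatchingOn O lt r g) {v : P} (hv : v ∈ O)
    (i : ℕ) : walk f g v i ∈ O := by
  induction i with
  | zero => exact hv
  | succ i ih => exact (letter_cases (p := IsMatchingOn O lt r) hf hg i).mem _ ih

theorem letter_walk_succ (hf : IsMatchingOn O lt r f) (hg : IsMatchingOn O lt r g) {v : P}
    (hv : v ∈ O) (i : ℕ) : letter f g i (walk f g v (i + 1)) = walk f g v i :=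
  (letter_cases (p := IsMatchingOn O lt r) hf hg i).invol _ (walk_mem hf hg hv i)

theorem walk_descent_step (hf : IsMatchingOn O lt r f) (hg : IsMatchingOn O lt r g) {v : P}
    (hv : v ∈ O) {i : ℕ} (hne : walk f g v (i + 1) ≠ walk g f v (i + 1))
    (hlt : lt (walk f g v (i + 1)) (walk g f v i))
    (h1 : r (walk f g v (i + 1)) = r v - (i + 1)) (h2 : r (walk g f v (i + 1)) = r v - (i + 1))
    (h3 : r (walk g f v i) = r v - i) :
    lt (walk f g v (i + 2)) (walk f g v (i + 1)) ∧
    lt (walk f g v (i + 2)) (walk g f v (i + 1)) ∧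
    r (walk f g v (i + 2)) = r v - (i + 2) := by
  have hL : IsMatchingOn O lt r (letter g f i) := letter_cases hg hf i
  have ha := walk_mem hf hg hv (i + 1)
  have hb := walk_mem hg hf hv i
  have key : lt (walk f g v (i + 2)) (walk g f v (i + 1)) :=
    hL.mono _ ha _ hb hlt (by omega) fun h => hne <| by
      rw [← hL.invol _ ha, h]; rfl
  have hr := hL.rank _ (walk_mem hf hg hv (i + 2)) _ (walk_mem hg hf hv (i + 1)) key
  obtain ⟨h4, h5⟩ := hL.lt_of_rank ha (show r (walk f g v (i + 2)) < _ by omega)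
  change _ = r (walk f g v (i + 2)) + 1 at h5
  exact ⟨h4, key, by omega⟩

/-- Two alternating walks which both descend from `v` keep descending until they meet. -/
theorem exists_walk_eq (hf : IsMatchingOn O lt r f) (hg : IsMatchingOn O lt r g)
    (hbd : ∃ c, ∀ z ∈ O, c ≤ r z) {v : P} (hv : v ∈ O) (hfv : lt (f v) v) (hgv : lt (g v) v) :
    ∃ k : ℕ, walk f g v (k + 1) = walk g f v (k + 1) ∧
      (∀ i, i < k → walk f g v (i + 1) ≠ walk g f v (i + 1)) ∧
      ∀ i, i ≤ k →
        (lt (walk f g v (i + 1)) (walk f g v i) ∧ lt (walk g f v (i + 1)) (walk g f v i) ∧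
          lt (walk f g v (i + 1)) (walk g f v i) ∧ lt (walk g f v (i + 1)) (walk f g v i)) ∧
        (r (walk f g v i) = r v - i ∧ r (walk g f v i) = r v - i) ∧
        r (walk f g v (i + 1)) = r v - (i + 1) ∧ r (walk g f v (i + 1)) = r v - (i + 1) := by
  have inv : ∀ i, (∀ j, j < i → walk f g v (j + 1) ≠ walk g f v (j + 1)) →
        (lt (walk f g v (i + 1)) (walk f g v i) ∧ lt (walk g f v (i + 1)) (walk g f v i) ∧
          lt (walk f g v (i + 1)) (walk g f v i) ∧ lt (walk g f v (i + 1)) (walk f g v i)) ∧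
        (r (walk f g v i) = r v - i ∧ r (walk g f v i) = r v - i) ∧
        r (walk f g v (i + 1)) = r v - (i + 1) ∧ r (walk g f v (i + 1)) = r v - (i + 1) := by
    intro i
    induction i with
    | zero =>
      intro _
      have h1 := (hf.lt_of_rank hv (hf.rank _ (hf.mem _ hv) _ hv hfv)).2
      have h2 := (hg.lt_of_rank hv (hg.rank _ (hg.mem _ hv) _ hv hgv)).2
      refine ⟨⟨hfv, hgv, hfv, hgv⟩, ?_, ?_⟩
      · simp [walk]
      · simp only [walk, letter]
        push_cast
        constructor <;> omega
    | succ i ih =>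
      intro hj
      obtain ⟨⟨-, -, h3, h4⟩, ⟨h5, h6⟩, h7, h8⟩ := ih fun j hji => hj j (by omega)
      have hne := hj i (by omega)
      obtain ⟨k1, k2, k3⟩ := walk_descent_step hf hg hv hne h3 h7 h8 h6
      obtain ⟨l1, l2, l3⟩ := walk_descent_step hg hf hv hne.symm h4 h8 h7 h5
      push_cast
      exact ⟨⟨k1, l1, k2, l2⟩, ⟨h7, h8⟩, by rw [k3]; ring, by rw [l3]; ring⟩
  have hex : ∃ k, walk f g v (k + 1) = walk g f v (k + 1) := by
    by_contra! hno
    obtain ⟨c, hc⟩ := hbd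
    have h1 := (inv (r v - c).toNat fun j _ => hno j).2.2.1
    have h2 := hc _ (walk_mem hf hg hv ((r v - c).toNat + 1))
    have h3 := hc v hv
    omega
  exact ⟨Nat.find hex, Nat.find_spec hex, fun i hi => Nat.find_min hex hi,
    fun i hi => inv i fun j hj => Nat.find_min hex (by omega)⟩

/-- Closing up of the two walks of `exists_walk_eq`. -/
theorem mem_walks_of_connected (hf : IsMatchingOn O lt r f) (hg : IsMatchingOn O lt r g)
    (hconn : ∀ v ∈ O, ∀ C : Set P, v ∈ C → (∀ z ∈ C, f z ∈ C) → (∀ z ∈ C, g z ∈ C) → O ⊆ C)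
    {v : P} (hv : v ∈ O) {k : ℕ} (hk : walk f g v (k + 1) = walk g f v (k + 1)) {z : P}
    (hz : z ∈ O) : ∃ i ≤ k + 1, z = walk f g v i ∨ z = walk g f v i := by
  have half : ∀ {f g : P → P}, IsMatchingOn O lt r f → IsMatchingOn O lt r g →
      walk f g v (k + 1) = walk g f v (k + 1) → ∀ i ≤ k + 1,
      (∃ j ≤ k + 1, letter f g i (walk f g v i) = walk f g v j ∨
        letter f g i (walk f g v i) = walk g f v j) ∧
      (∃ j ≤ k + 1, letter g f i (walk f g v i) = walk f g v j ∨
        letter g f i (walk f g v i) = walk g f v j) := by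
    intro f g hf hg hk i hi
    constructor
    · rcases hi.lt_or_eq with hi | rfl
      · exact ⟨i + 1, hi, Or.inl rfl⟩
      · refine ⟨k, by omega, Or.inr ?_⟩
        rw [hk]
        exact letter_walk_succ hg hf hv k
    · cases i with
      | zero => exact ⟨1, by omega, Or.inr rfl⟩
      | succ i => exact ⟨i, by omega, Or.inl (letter_walk_succ hf hg hv i)⟩
  refine hconn v hv {z | ∃ i ≤ k + 1, z = walk f g v i ∨ z = walk g f v i}
    ⟨0, by omega, Or.inl rfl⟩ ?_ ?_ hz <;>
  · rintro z ⟨i, hi, rfl | rfl⟩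
    · obtain ⟨h1, h2⟩ := half hf hg hk i hi
      rcases letter_pair f g i with ⟨e1, e2⟩ | ⟨e1, e2⟩ <;> rw [e1] at h1 <;> rw [e2] at h2 <;>
        assumption
    · obtain ⟨⟨j, hj, h1⟩, ⟨j', hj', h2⟩⟩ := half hg hf hk.symm i hi
      rcases letter_pair f g i with ⟨e1, e2⟩ | ⟨e1, e2⟩ <;> rw [e2] at h1 <;> rw [e1] at h2 <;>
        first
        | exact ⟨j, hj, h1.symm⟩
        | exact ⟨j', hj', h2.symm⟩

/-- A local minimum forces a local maximum. -/
theorem exists_local_max_of_local_min (hf : IsMatchingOn O lt r f) (hg : IsMatchingOn O lt r g)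
    (hbd : ∃ c, ∀ z ∈ O, r z ≤ c) {v : P} (hv : v ∈ O) (hfv : lt v (f v)) (hgv : lt v (g v)) :
    ∃ t ∈ O, lt (f t) t ∧ lt (g t) t := by
  obtain ⟨c, hc⟩ := hbd
  obtain ⟨k, hk, -, h⟩ := exists_walk_eq hf.flip hg.flip
    ⟨-c, fun z hz => neg_le_neg (hc z hz)⟩ hv hfv hgv
  refine ⟨_, walk_mem hf hg hv (k + 1), ?_⟩
  obtain ⟨⟨h1, h2, -, -⟩, -⟩ := h k le_rfl
  have e1 := letter_walk_succ hf hg hv k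
  have e2 := letter_walk_succ hg hf hv k
  rw [← hk] at e2 h2
  rw [← e1] at h1
  rw [← e2] at h2
  rcases letter_pair f g k with ⟨e3, e4⟩ | ⟨e3, e4⟩ <;> rw [e3] at h1 <;> rw [e4] at h2
  · exact ⟨h1, h2⟩
  · exact ⟨h2, h1⟩

/-- Without local extrema, the walk from a fixed element of maximal rank descends to a fixed
element. -/
theorem exists_walk_fixed (hf : IsMatchingOn O lt r f) (hg : IsMatchingOn O lt r g)
    (hbd : ∃ c, ∀ z ∈ O, c ≤ r z) (hmin : ∀ z ∈ O, ¬ (lt z (f z) ∧ lt z (g z))) {v : P}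
    (hv : v ∈ O) (hmax : ∀ z ∈ O, r z ≤ r v) :
    ∃ k : ℕ, walk f g v (k + 1) = walk f g v k ∧
      ∀ i, i < k → lt (walk f g v (i + 1)) (walk f g v i) := by
  have inv : ∀ i, (∀ j, j ≤ i → walk f g v (j + 1) ≠ walk f g v j) →
      lt (walk f g v (i + 1)) (walk f g v i) ∧ r (walk f g v (i + 1)) = r v - (i + 1) := by
    intro i
    induction i with
    | zero =>
      intro hj
      have h0 : f v ≠ v := hj 0 le_rfl
      have := hmax _ (hf.mem v hv)
      rcases hf.step v hv with ⟨h1, h2⟩ | h | ⟨-, h2⟩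
      · refine ⟨h1, ?_⟩
        simp only [walk, letter]
        push_cast
        omega
      · exact absurd h h0
      · omega
    | succ i ih =>
      intro hj
      obtain ⟨h1, h2⟩ := ih fun j hji => hj j (by omega)
      have hL : IsMatchingOn O lt r (letter g f i) := letter_cases hg hf i
      have ha := walk_mem hf hg hv (i + 1)
      rcases hL.step _ ha with ⟨h3, h4⟩ | h | ⟨h3, -⟩
      · refine ⟨h3, ?_⟩
        change _ = r (walk f g v (i + 1 + 1)) + 1 at h4
        push_cast
        omega
      · exact absurd h (hj (i + 1) le_rfl)
      · have h4 : lt (walk f g v (i + 1)) (letter f g i (walk f g v (i + 1))) := by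
          rw [letter_walk_succ hf hg hv i]
          exact h1
        refine absurd ?_ (hmin _ ha)
        rcases letter_pair f g i with ⟨e1, e2⟩ | ⟨e1, e2⟩ <;> rw [e1] at h4 <;> rw [e2] at h3
        · exact ⟨h4, h3⟩
        · exact ⟨h3, h4⟩
  have hex : ∃ k, walk f g v (k + 1) = walk f g v k := by
    by_contra! hno
    obtain ⟨c, hc⟩ := hbd
    have h1 := (inv (r v - c).toNat fun j _ => hno j).2
    have h2 := hc _ (walk_mem hf hg hv ((r v - c).toNat + 1))
    have h3 := hc v hv
    omega
  exact ⟨Nat.find hex, Nat.find_spec hex,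
    fun i hi => (inv i fun j hj => Nat.find_min hex (by omega)).1⟩

end Walk

theorem letter_rel {α β : Type*} {p : α → β → Prop} {f g : α} {A B : β} (h1 : p f A) (h2 : p g B)
    (i : ℕ) : p (letter f g i) (letter A B i) := by
  induction i generalizing f g A B with
  | zero => exact h1
  | succ i ih => exact ih h2 h1

/-! ### Hecke operators attached to matchings -/

/-- The operator `A` maps the vector `e z` to `e (f z)` if `f z < z`, and to `x • e z` if `z` is
fixed by `f`. -/
def ActsAs {P R V : Type*} [LT P] [CommRing R] [AddCommGroup V] [Module R V] (O : Set P)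
    (e : P → V) (x : R) (f : P → P) (A : Module.End R V) : Prop :=
  ∀ z ∈ O, (f z < z → A (e z) = e (f z)) ∧ (f z = z → A (e z) = x • e z)

section Braid

variable {P R V : Type*} [PartialOrder P] [CommRing R] [AddCommGroup V] [Module R V]
  {O : Set P} {r : P → ℤ} {f g : P → P} {e : P → V} {x : R} {A B : Module.End R V}

theorem altProd_apply_walk (hf : IsMatchingOn O (· < ·) r f) (hg : IsMatchingOn O (· < ·) r g)
    (hA : ActsAs O e x f A) (hB : ActsAs O e x g B) {v : P} (hv : v ∈ O) {n : ℕ}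
    (h : ∀ i < n, walk f g v (i + 1) < walk f g v i) :
    altProd A B n (e v) = e (walk f g v n) := by
  induction n with
  | zero => rfl
  | succ n ih =>
    rw [altProd_succ_left, Module.End.mul_apply, ih fun i hi => h i (by omega)]
    exact ((letter_rel (p := ActsAs O e x) hA hB n) _ (walk_mem hf hg hv n)).1 (h n (by omega))

theorem altProd_eq_on_walk {c d : R}
    (hA2 : A * A = c • A + d • (1 : Module.End R V))
    (hB2 : B * B = c • B + d • (1 : Module.End R V))
    (hf : IsMatchingOn O (· < ·) r f) (hg : IsMatchingOn O (· < ·) r g)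
    (hA : ActsAs O e x f A) (hB : ActsAs O e x g B) {v : P} (hv : v ∈ O) {n k : ℕ}
    (h : ∀ i < k, walk f g v (i + 1) < walk f g v i)
    (hn : altProd A B n (e v) = altProd B A n (e v)) :
    altProd A B n (e (walk f g v k)) = altProd B A n (e (walk f g v k)) := by
  induction k with
  | zero => exact hn
  | succ k ih =>
    have hk := altProd_apply_letter hA2 hB2 (ih fun i hi => h i (by omega))
    have := ((letter_rel (p := ActsAs O e x) hA hB k) _ (walk_mem hf hg hv k)).1 (h k (by omega))
    change _ = e (walk f g v (k + 1)) at this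
    rw [← this]
    exact letter_cases (p := fun X : Module.End R V =>
      altProd A B n (X (e (walk f g v k))) = altProd B A n (X (e (walk f g v k)))) hk.1 hk.2 k

/-- The orbit of a local maximum is a dihedral interval, whose rank is the length of a braid
relation. -/
theorem exists_braid_of_local_max {c d : R}
    (hA2 : A * A = c • A + d • (1 : Module.End R V))
    (hB2 : B * B = c • B + d • (1 : Module.End R V))
    (hf : IsMatchingOn O (· < ·) r f) (hg : IsMatchingOn O (· < ·) r g)
    (hA : ActsAs O e x f A) (hB : ActsAs O e x g B) (hfin : O.Finite)
    (hconn : ∀ v ∈ O, ∀ C : Set P, v ∈ C → (∀ z ∈ C, f z ∈ C) → (∀ z ∈ C, g z ∈ C) → O ⊆ C)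
    (hext : ∀ X Y : Module.End R V, (∀ z ∈ O, X (e z) = Y (e z)) → X = Y)
    {v : P} (hv : v ∈ O) (hfv : f v < v) (hgv : g v < v) :
    ∃ n, altProd A B n = altProd B A n ∧ IsDihedralIntervalOfRank O n := by
  obtain ⟨c₀, hc₀⟩ := (hfin.image r).bddBelow
  obtain ⟨k, hk, hne, h⟩ := exists_walk_eq hf hg
    ⟨c₀, fun z hz => hc₀ (Set.mem_image_of_mem r hz)⟩ hv hfv hgv
  have hmem := fun z (hz : z ∈ O) => mem_walks_of_connected hf hg hconn hv hk hz
  refine ⟨k + 1, ?_, ?_⟩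
  · have hn : altProd A B (k + 1) (e v) = altProd B A (k + 1) (e v) := by
      rw [altProd_apply_walk hf hg hA hB hv fun i hi => (h i (by omega)).1.1,
        altProd_apply_walk hg hf hB hA hv fun i hi => (h i (by omega)).1.2.1, hk]
    refine hext _ _ fun z hz => ?_
    obtain ⟨i, hi, rfl | rfl⟩ := hmem z hz
    · exact altProd_eq_on_walk hA2 hB2 hf hg hA hB hv (fun j hj => (h j (by omega)).1.1) hn
    · exact (altProd_eq_on_walk hB2 hA2 hg hf hB hA hv
        (fun j hj => (h j (by omega)).1.2.1) hn.symm).symm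
  · have hra : ∀ i ≤ k + 1, r (walk f g v i) = r v - i ∧ r (walk g f v i) = r v - i := by
      intro i hi
      rcases hi.lt_or_eq with hi | rfl
      · exact (h i (by omega)).2.1
      · push_cast
        exact (h k le_rfl).2.2
    have hlt : ∀ i j, i < j → j ≤ k + 1 →
        (walk f g v j < walk f g v i ∧ walk g f v j < walk g f v i) ∧
        walk f g v j < walk g f v i ∧ walk g f v j < walk f g v i := by
      intro i j hij
      induction j, hij using Nat.le_induction with
      | base =>
        intro hi
        obtain ⟨h1, h2, h3, h4⟩ := (h i (by omega)).1
        exact ⟨⟨h1, h2⟩, h3, h4⟩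
      | succ j hj ih =>
        intro hjk
        obtain ⟨h1, h2, -, -⟩ := (h j (by omega)).1
        obtain ⟨⟨i1, i2⟩, i3, i4⟩ := ih (by omega)
        exact ⟨⟨h1.trans i1, h2.trans i2⟩, h1.trans i3, h2.trans i4⟩
    set ρ : P → ℕ := fun z => (r z - (r v - (k + 1))).toNat with hρ
    have hρw : ∀ i ≤ k + 1, ρ (walk f g v i) = k + 1 - i ∧ ρ (walk g f v i) = k + 1 - i := by
      intro i hi
      simp only [hρ, (hra i hi).1, (hra i hi).2]
      omega
    have hρlt : ∀ a ∈ O, ∀ b ∈ O, ρ a < ρ b → a < b := by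
      intro a ha b hb hab
      obtain ⟨i, hi, hai⟩ := hmem a ha
      obtain ⟨j, hj, hbj⟩ := hmem b hb
      have hji : j < i := by
        rcases hai with rfl | rfl <;> rcases hbj with rfl | rfl <;>
          simp only [hρw _ hi, hρw _ hj] at hab <;> omega
      obtain ⟨⟨h1, h2⟩, h3, h4⟩ := hlt j i hji hi
      rcases hai with rfl | rfl <;> rcases hbj with rfl | rfl <;> assumption
    have hρmono : ∀ a ∈ O, ∀ b ∈ O, a < b → ρ a < ρ b := by
      intro a ha b hb hab
      have h1 := hf.rank a ha b hb hab
      obtain ⟨i, hi, hai⟩ := hmem a ha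
      have h2 : r a = r v - i := by rcases hai with rfl | rfl <;> simp [hra i hi]
      simp only [hρ]
      omega
    refine ⟨hfin, ρ, ⟨walk f g v (k + 1), walk_mem hf hg hv _, fun z hz => ?_, ?_⟩,
      ⟨v, hv, fun z hz => ?_, ?_⟩, fun a b ⟨ha, hb, hab, hno⟩ => ?_, fun i h0 hi => ?_, hρlt⟩
    · obtain ⟨i, hi, hzi⟩ := hmem z hz
      rcases hi.lt_or_eq with hi | rfl
      · obtain ⟨⟨h1, h2⟩, h3, h4⟩ := hlt i (k + 1) hi le_rfl
        rcases hzi with rfl | rfl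
        · exact h1.le
        · exact h3.le
      · rcases hzi with rfl | rfl
        · exact le_rfl
        · exact hk.le
    · simp [hρw (k + 1) le_rfl]
    · obtain ⟨i, hi, hzi⟩ := hmem z hz
      rcases Nat.eq_zero_or_pos i with rfl | h0
      · rcases hzi with rfl | rfl <;> exact le_rfl
      · obtain ⟨⟨h1, h2⟩, h3, h4⟩ := hlt 0 i h0 hi
        rcases hzi with rfl | rfl
        · exact h1.le
        · exact h4.le
    · exact (hρw 0 (by omega)).1
    · have hlt' := hρmono a ha b hb hab
      by_contra hcon
      obtain ⟨i, hi, hbi⟩ := hmem b hb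
      have hb' : ρ b = k + 1 - i := by rcases hbi with rfl | rfl <;> simp [hρw i hi]
      have hc := (hρw (k + 1 - (ρ a + 1)) (by omega)).1
      have hcO := walk_mem hf hg hv (k + 1 - (ρ a + 1))
      exact hno _ hcO ⟨hρlt _ ha _ hcO (by omega), hρlt _ hcO _ hb (by omega)⟩
    · obtain ⟨j, hj, hij⟩ : ∃ j, j < k ∧ i = k - j := ⟨k - i, by omega, by omega⟩
      have hset : {z ∈ O | ρ z = i} = {walk f g v (j + 1), walk g f v (j + 1)} := by
        ext z
        simp only [Set.mem_ofPred_eq, Set.mem_insert_iff, Set.mem_singleton_iff]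
        constructor
        · rintro ⟨hz, hzi⟩
          obtain ⟨l, hl, hzl⟩ := hmem z hz
          have h1 : ρ z = k + 1 - l := by rcases hzl with rfl | rfl <;> simp [hρw l hl]
          obtain rfl : l = j + 1 := by omega
          exact hzl
        · have := hρw (j + 1) (by omega)
          rintro (rfl | rfl)
          · exact ⟨walk_mem hf hg hv _, by omega⟩
          · exact ⟨walk_mem hg hf hv _, by omega⟩
      rw [hset, Set.ncard_pair (hne j hj)]

/-- The orbit of a fixed maximal element is a chain, whose cardinality is the length of a braid
relation. -/
theorem exists_braid_of_fixed {c d : R}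
    (hA2 : A * A = c • A + d • (1 : Module.End R V))
    (hB2 : B * B = c • B + d • (1 : Module.End R V))
    (hf : IsMatchingOn O (· < ·) r f) (hg : IsMatchingOn O (· < ·) r g)
    (hA : ActsAs O e x f A) (hB : ActsAs O e x g B) (hfin : O.Finite)
    (hconn : ∀ v ∈ O, ∀ C : Set P, v ∈ C → (∀ z ∈ C, f z ∈ C) → (∀ z ∈ C, g z ∈ C) → O ⊆ C)
    (hext : ∀ X Y : Module.End R V, (∀ z ∈ O, X (e z) = Y (e z)) → X = Y)
    (hmin : ∀ z ∈ O, ¬ (z < f z ∧ z < g z))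
    {v : P} (hv : v ∈ O) (hmax : ∀ z ∈ O, r z ≤ r v) (hgv : g v = v) :
    ∃ n, altProd A B n = altProd B A n ∧ (∀ a ∈ O, ∀ b ∈ O, a ≤ b ∨ b ≤ a) ∧ O.ncard = n := by
  obtain ⟨c₀, hc₀⟩ := (hfin.image r).bddBelow
  obtain ⟨k, hk, h⟩ := exists_walk_fixed hf hg
    ⟨c₀, fun z hz => hc₀ (Set.mem_image_of_mem r hz)⟩ hmin hv hmax
  have hmem : O = walk f g v '' Set.Iio (k + 1) := by
    apply Set.Subset.antisymm
    · have half : ∀ i < k + 1, letter f g i (walk f g v i) ∈ walk f g v '' Set.Iio (k + 1) ∧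
          letter g f i (walk f g v i) ∈ walk f g v '' Set.Iio (k + 1) := by
        intro i hi
        constructor
        · rcases (Nat.lt_succ_iff.mp hi).lt_or_eq with hi | rfl
          · exact ⟨i + 1, Nat.succ_lt_succ hi, rfl⟩
          · exact ⟨i, hi, hk.symm⟩
        · cases i with
          | zero => exact ⟨0, hi, hgv.symm⟩
          | succ i => exact ⟨i, by simp only [Set.mem_Iio]; omega,
              (letter_walk_succ hf hg hv i).symm⟩
      refine hconn v hv _ ⟨0, Nat.succ_pos k, rfl⟩ ?_ ?_ <;>
      · rintro z ⟨i, hi, rfl⟩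
        obtain ⟨h1, h2⟩ := half i hi
        rcases letter_pair f g i with ⟨e1, e2⟩ | ⟨e1, e2⟩ <;> rw [e1] at h1 <;> rw [e2] at h2 <;>
          assumption
    · rintro z ⟨i, -, rfl⟩
      exact walk_mem hf hg hv i
  have hanti : ∀ i j, i < j → j ≤ k → walk f g v j < walk f g v i := by
    intro i j hij
    induction j, hij using Nat.le_induction with
    | base => exact fun hi => h i hi
    | succ j hj ih => exact fun hjk => (h j hjk).trans (ih (by omega))
  refine ⟨k + 1, ?_, ?_, ?_⟩
  · have hn : altProd A B (k + 1) (e v) = altProd B A (k + 1) (e v) := by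
      rw [altProd_succ_left, Module.End.mul_apply, altProd_apply_walk hf hg hA hB hv h,
        ((letter_rel (p := ActsAs O e x) hA hB k) _ (walk_mem hf hg hv k)).2 hk]
      change _ = altProd A B k (B (e v))
      rw [(hB v hv).2 hgv, map_smul, altProd_apply_walk hf hg hA hB hv h]
    refine hext _ _ fun z hz => ?_
    rw [hmem] at hz
    obtain ⟨i, hi, rfl⟩ := hz
    exact altProd_eq_on_walk hA2 hB2 hf hg hA hB hv
      (fun j hj => h j (by simp only [Set.mem_Iio] at hi; omega)) hn
  · rw [hmem]
    rintro _ ⟨i, hi, rfl⟩ _ ⟨j, hj, rfl⟩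
    rcases lt_trichotomy i j with hij | rfl | hij
    · exact Or.inr (hanti i j hij (Nat.lt_succ_iff.mp hj)).le
    · exact Or.inl le_rfl
    · exact Or.inl (hanti j i hij (Nat.lt_succ_iff.mp hi)).le
  · rw [hmem, Set.InjOn.ncard_image]
    · simp [Set.ncard_eq_toFinset_card']
    · intro i hi j hj hij
      rcases lt_trichotomy i j with h1 | h1 | h1
      · exact absurd hij (hanti i j h1 (Nat.lt_succ_iff.mp hj)).ne'
      · exact h1
      · exact absurd hij (hanti j i h1 (Nat.lt_succ_iff.mp hi)).ne

theorem exists_braid {c d : R}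
    (hA2 : A * A = c • A + d • (1 : Module.End R V))
    (hB2 : B * B = c • B + d • (1 : Module.End R V))
    (hf : IsMatchingOn O (· < ·) r f) (hg : IsMatchingOn O (· < ·) r g)
    (hA : ActsAs O e x f A) (hB : ActsAs O e x g B) (hfin : O.Finite) (hne : O.Nonempty)
    (hconn : ∀ v ∈ O, ∀ C : Set P, v ∈ C → (∀ z ∈ C, f z ∈ C) → (∀ z ∈ C, g z ∈ C) → O ⊆ C)
    (hext : ∀ X Y : Module.End R V, (∀ z ∈ O, X (e z) = Y (e z)) → X = Y) :
    ∃ n, altProd A B n = altProd B A n ∧ (IsDihedralIntervalOfRank O n ∨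
      (∀ a ∈ O, ∀ b ∈ O, a ≤ b ∨ b ≤ a) ∧ O.ncard = n) := by
  by_cases hlm : ∃ t ∈ O, f t < t ∧ g t < t
  · obtain ⟨t, ht, hft, hgt⟩ := hlm
    obtain ⟨n, h1, h2⟩ :=
      exists_braid_of_local_max hA2 hB2 hf hg hA hB hfin hconn hext ht hft hgt
    exact ⟨n, h1, Or.inl h2⟩
  have hmin : ∀ z ∈ O, ¬ (z < f z ∧ z < g z) := by
    rintro z hz ⟨h1, h2⟩
    obtain ⟨c₀, hc₀⟩ := (hfin.image r).bddAbove
    exact hlm (exists_local_max_of_local_min hf hg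
      ⟨c₀, fun z hz => hc₀ (Set.mem_image_of_mem r hz)⟩ hz h1 h2)
  obtain ⟨v, hv, hmax⟩ := hfin.exists_maximalFor r O hne
  have hmax : ∀ z ∈ O, r z ≤ r v := fun z hz => by
    rcases le_total (r v) (r z) with h | h
    · exact hmax hz h
    · exact h
  have hfix : f v = v ∨ g v = v := by
    have h1 := hmax _ (hf.mem v hv)
    have h2 := hmax _ (hg.mem v hv)
    rcases hf.step v hv with ⟨h3, -⟩ | h | ⟨-, h3⟩
    · rcases hg.step v hv with ⟨h4, -⟩ | h | ⟨-, h4⟩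
      · exact absurd ⟨v, hv, h3, h4⟩ hlm
      · exact Or.inr h
      · omega
    · exact Or.inl h
    · omega
  rcases hfix with hfv | hgv
  · obtain ⟨n, h1, h2⟩ := exists_braid_of_fixed hB2 hA2 hg hf hB hA hfin
      (fun v hv C h1 h2 h3 => hconn v hv C h1 h3 h2) hext
      (fun z hz h => hmin z hz h.symm) hv hmax hfv
    exact ⟨n, h1.symm, Or.inr h2⟩
  · obtain ⟨n, h1, h2⟩ := exists_braid_of_fixed hA2 hB2 hf hg hA hB hfin hconn hext hmin hv hmax
      hgv
    exact ⟨n, h1, Or.inr h2⟩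

end Braid

/-! ### Pircons are graded -/

section Pircon

variable {P : Type*} [PartialOrder P]

theorem IsPircon.finite_Iic (hP : IsPircon P) (w : P) : (Set.Iic w).Finite := by
  by_cases hw : IsMin w
  · rw [hw.Iic_eq]
    exact Set.finite_singleton w
  · exact (hP w hw).1

theorem IsPircon.exists_le_covBy (hP : IsPircon P) {x y : P} (h : x < y) :
    ∃ c, x ≤ c ∧ c ⋖ y := by
  obtain ⟨c, hxc, hc⟩ := ((hP.finite_Iic y).subset Set.Iio_subset_Iic_self).exists_le_maximal
    (show x ∈ Set.Iio y from h)
  exact ⟨c, hxc, hc.prop, fun d hcd hdy => (hc.not_gt hdy) hcd⟩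

theorem IsPircon.induction_on (hP : IsPircon P) {p : P → Prop} (w : P)
    (h : ∀ w, (∀ v < w, p v) → p w) : p w := by
  induction hn : (Set.Iic w).ncard using Nat.strong_induction_on generalizing w with
  | _ n ih =>
    subst hn
    exact h w fun v hv => ih _
      (Set.ncard_lt_ncard (Set.Iic_ssubset_Iic.mpr hv) (hP.finite_Iic w)) v rfl

theorem IsSPMof.le_or_le (hP : IsPircon P) {w : P} {M : P → P} (hM : IsSPMof w M) {x z : P}
    (hxz : x ≤ z) (hz : z ≤ w) : M x ≤ z ∨ M x ≤ M z := by
  induction z using hP.induction_on with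
  | _ z ih =>
    rcases hxz.eq_or_lt with rfl | hlt
    · exact Or.inr le_rfl
    obtain ⟨c, hxc, hcz⟩ := hP.exists_le_covBy hlt
    rcases ih c hcz.lt hxc (hcz.le.trans hz) with h | h
    · exact Or.inl (h.trans hcz.le)
    · by_cases hMc : M c = z
      · exact Or.inl (hMc ▸ h)
      · exact Or.inr (h.trans (hM.2.2.2.2 c z (hcz.le.trans hz) hz hcz hMc).le)

theorem IsSPMof.lt_of_covBy_top {w : P} {M : P → P} (hM : IsSPMof w M) {c : P} (hc : c ⋖ w)
    (hne : c ≠ M w) : M c < M w ∧ M c ⋖ c := by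
  obtain ⟨-, hinv, htop, hstep, hmono⟩ := hM
  have hlt : M c < M w := hmono c w hc.le le_rfl hc fun h => hne <| by
    rw [← h, hinv c hc.le]
  have hno : ¬ c < M w := fun h => hc.2 h htop.lt
  refine ⟨hlt, ?_⟩
  rcases hstep c hc.le with h | h | h
  · exact h
  · exact absurd (h ▸ hlt) hno
  · exact absurd (h.lt.trans hlt) hno

theorem IsSPMof.covBy_of_covBy_top (hP : IsPircon P) {w : P} {M : P → P} (hM : IsSPMof w M)
    {c : P} (hc : c ⋖ w) (hne : c ≠ M w) : M c ⋖ M w := by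
  have hlt := (hM.lt_of_covBy_top hc hne).1
  have htop := hM.2.2.1
  have hinv := hM.2.1
  refine ⟨hlt, fun d hcd hd => ?_⟩
  have hdw : d ≤ w := hd.le.trans htop.le
  rcases hM.le_or_le hP hcd.le hdw with h | h <;> rw [hinv c hc.le] at h
  · exact hc.2 (h.trans_lt hd) htop.lt
  · rcases h.eq_or_lt with h | h
    · rw [h, hinv d hdw] at hcd
      exact hcd.false
    · rcases (hM.1 d hdw).eq_or_lt with h' | h'
      · rw [← h', hinv d hdw] at hd
        exact hd.false
      · exact hc.2 h h'

theorem IsPircon.height_lt_top_and_covBy (hP : IsPircon P) (w : P) :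
    Order.height w < ⊤ ∧ ∀ c, c ⋖ w → Order.height w = Order.height c + 1 := by
  induction w using hP.induction_on with
  | _ w ih =>
    by_cases hw : IsMin w
    · exact ⟨by simp [Order.height_eq_zero.mpr hw], fun c hc => absurd hc.lt hw.not_lt⟩
    obtain ⟨M, hM⟩ := (hP w hw).2
    have htop : M w ⋖ w := hM.2.2.1
    have hco : ∀ c, c ⋖ w → Order.height c = Order.height (M w) := by
      intro c hc
      by_cases hne : c = M w
      · rw [hne]
      · rw [(ih c hc.lt).2 _ (hM.lt_of_covBy_top hc hne).2,
          (ih _ htop.lt).2 _ (hM.covBy_of_covBy_top hP hc hne)]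
    have heq : Order.height w = Order.height (M w) + 1 := by
      refine le_antisymm ?_ (Order.height_add_one_le htop.lt)
      rw [Order.height_eq_iSup_lt_height]
      refine iSup₂_le fun b hb => ?_
      obtain ⟨c, hbc, hc⟩ := hP.exists_le_covBy hb
      rw [← hco c hc]
      gcongr
    refine ⟨?_, fun c hc => by rw [heq, hco c hc]⟩
    rw [heq]
    exact ENat.add_lt_top.mpr ⟨(ih _ htop.lt).1, by simp⟩

theorem IsPircon.exists_rank (hP : IsPircon P) :
    ∃ r : P → ℤ, StrictMono r ∧ ∀ x y, x ⋖ y → r y = r x + 1 := by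
  refine ⟨fun z => (Order.height z).toNat, fun x y h => ?_, fun x y h => ?_⟩
  · have hx := (hP.height_lt_top_and_covBy x).1
    have hy := (hP.height_lt_top_and_covBy y).1
    have := Order.height_strictMono h hx
    rw [← ENat.natCast_toNat hx.ne, ← ENat.natCast_toNat hy.ne] at this
    exact Int.ofNat_lt.mpr (ENat.natCast_lt_natCast.mp this)
  · have hx := (hP.height_lt_top_and_covBy x).1.ne
    simp only [(hP.height_lt_top_and_covBy y).2 x h, ENat.toNat_add hx ENat.one_ne_top]
    simp

theorem IsSPMof.isMatchingOn {w : P} {M : P → P} (hM : IsSPMof w M) {r : P → ℤ}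
    (hr : StrictMono r) (hcov : ∀ x y, x ⋖ y → r y = r x + 1) {O : Set P}
    (hO : ∀ z ∈ O, z ≤ w) (hmem : ∀ z ∈ O, M z ∈ O) : IsMatchingOn O (· < ·) r M where
  mem := hmem
  invol z hz := hM.2.1 z (hO z hz)
  step z hz := by
    rcases hM.2.2.2.1 z (hO z hz) with h | h | h
    · exact Or.inl ⟨h.lt, hcov _ _ h⟩
    · exact Or.inr (Or.inl h)
    · exact Or.inr (Or.inr ⟨h.lt, hcov _ _ h⟩)
  mono x hx y hy hlt hxy hne :=
    hM.2.2.2.2 x y (hO x hx) (hO y hy) ⟨hlt, fun d h1 h2 => by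
      have := hr h1
      have := hr h2
      omega⟩ hne
  rank _ _ _ _ h := hr h

theorem IsSPMof.covBy_of_lt {w : P} {M : P → P} (hM : IsSPMof w M) {z : P} (hz : z ≤ w)
    (h : M z < z) : M z ⋖ z := by
  rcases hM.2.2.2.1 z hz with h' | h' | h'
  · exact h'
  · exact absurd h' h.ne
  · exact absurd h'.lt h.asymm

end Pircon

theorem mul_self_eq_of_actsAs {P R V : Type*} [PartialOrder P] [CommRing R] [AddCommGroup V]
    [Module R V] {O : Set P} {r : P → ℤ} {f : P → P} {e : P → V} {x q : R}
    {A : Module.End R V} (hf : IsMatchingOn O (· < ·) r f) (hA : ActsAs O e x f A)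
    (hup : ∀ z ∈ O, z < f z → A (e z) = q • e (f z) + (q - 1) • e z)
    (hx : x * x = (q - 1) * x + q)
    (hext : ∀ X Y : Module.End R V, (∀ z ∈ O, X (e z) = Y (e z)) → X = Y) :
    A * A = (q - 1) • A + q • (1 : Module.End R V) := by
  refine hext _ _ fun z hz => ?_
  simp only [Module.End.mul_apply, LinearMap.add_apply, LinearMap.smul_apply,
    Module.End.one_apply]
  have hfz := hf.mem z hz
  have hinv := hf.invol z hz
  rcases hf.step z hz with ⟨h, -⟩ | h | ⟨h, -⟩
  · rw [(hA z hz).1 h, hup _ hfz (by rwa [hinv]), hinv, add_comm]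
  · rw [(hA z hz).2 h, map_smul, (hA z hz).2 h, smul_smul, smul_smul, ← add_smul, hx]
  · rw [hup z hz h, map_add, map_smul, map_smul, (hA _ hfz).1 (by rwa [hinv]), hinv,
      hup z hz h]
    abel

/-! ### Orbits -/

section Orbit

variable {P : Type*} {M N : P → P} {u : P}

theorem orbitMN_subset {C : Set P} (hu : u ∈ C) (hM : ∀ z ∈ C, M z ∈ C)
    (hN : ∀ z ∈ C, N z ∈ C) : orbitMN M N u ⊆ C := by
  intro v hv
  induction hv with
  | refl => exact hu
  | tail _ h ih =>
    rcases h with rfl | rfl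
    · exact hM _ ih
    · exact hN _ ih

theorem left_mem_orbitMN {z : P} (hz : z ∈ orbitMN M N u) : M z ∈ orbitMN M N u :=
  Relation.ReflTransGen.tail hz (Or.inl rfl)

theorem right_mem_orbitMN {z : P} (hz : z ∈ orbitMN M N u) : N z ∈ orbitMN M N u :=
  Relation.ReflTransGen.tail hz (Or.inr rfl)

theorem orbitMN_subset_of_mem (hM : ∀ z ∈ orbitMN M N u, M (M z) = z)
    (hN : ∀ z ∈ orbitMN M N u, N (N z) = z) {v : P} (hv : v ∈ orbitMN M N u) {C : Set P}
    (hvC : v ∈ C) (hMC : ∀ z ∈ C, M z ∈ C) (hNC : ∀ z ∈ C, N z ∈ C) : orbitMN M N u ⊆ C := by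
  refine orbitMN_subset ?_ hMC hNC
  induction hv with
  | refl => exact hvC
  | @tail a b ha h ih =>
    refine ih ?_
    rcases h with rfl | rfl
    · exact hM a ha ▸ hMC _ hvC
    · exact hN a ha ▸ hNC _ hvC

/-- The basis vector of `𝔐^O` attached to `z`, or zero if `z ∉ O`. -/
def orbitBasis (M N : P → P) (u : P) (z : P) : OrbMod M N u :=
  if hz : z ∈ orbitMN M N u then Finsupp.single ⟨z, hz⟩ 1 else 0

theorem orbitBasis_of_mem {z : P} (hz : z ∈ orbitMN M N u) :
    orbitBasis M N u z = Finsupp.single ⟨z, hz⟩ 1 := dif_pos hz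

theorem end_ext_orbitBasis {X Y : Module.End Rq (OrbMod M N u)}
    (h : ∀ z ∈ orbitMN M N u, X (orbitBasis M N u z) = Y (orbitBasis M N u z)) : X = Y := by
  refine Finsupp.lhom_ext' fun z => LinearMap.ext_ring ?_
  have := h z.1 z.2
  rw [orbitBasis_of_mem z.2] at this
  exact this

variable [PartialOrder P] {x : Rq} {z : P}

theorem TM_orbitBasis (hz : z ∈ orbitMN M N u) :
    TM M N u x (orbitBasis M N u z) =
      if M z = z then x • orbitBasis M N u z
      else if M z ⋖ z then orbitBasis M N u (M z)
      else qq • orbitBasis M N u (M z) + (qq - 1) • orbitBasis M N u z := by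
  rw [orbitBasis_of_mem hz, orbitBasis_of_mem (left_mem_orbitMN hz), TM,
    Finsupp.linearCombination_single, one_smul]
  rfl

theorem TN_orbitBasis (hz : z ∈ orbitMN M N u) :
    TN M N u x (orbitBasis M N u z) =
      if N z = z then x • orbitBasis M N u z
      else if N z ⋖ z then orbitBasis M N u (N z)
      else qq • orbitBasis M N u (N z) + (qq - 1) • orbitBasis M N u z := by
  rw [orbitBasis_of_mem hz, orbitBasis_of_mem (right_mem_orbitMN hz), TN,
    Finsupp.linearCombination_single, one_smul]
  rfl

theorem IsSPMof.actsAs {w : P} {f : P → P} (hf : IsSPMof w f) {V : Type*} [AddCommGroup V]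
    [Module Rq V] {O : Set P} (hO : ∀ z ∈ O, z ≤ w) {e : P → V} {A : Module.End Rq V}
    (h : ∀ z ∈ O, A (e z) = if f z = z then x • e z
      else if f z ⋖ z then e (f z) else qq • e (f z) + (qq - 1) • e z) :
    ActsAs O e x f A ∧ ∀ z ∈ O, z < f z → A (e z) = qq • e (f z) + (qq - 1) • e z := by
  refine ⟨fun z hz => ⟨fun hlt => ?_, fun heq => ?_⟩, fun z hz hlt => ?_⟩
  · rw [h z hz, if_neg hlt.ne, if_pos (hf.covBy_of_lt (hO z hz) hlt)]
  · rw [h z hz, if_pos heq]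
  · rw [h z hz, if_neg hlt.ne', if_neg fun hc => hc.lt.asymm hlt]

end Orbit

/-- Let `P` be a pircon, `w` non-minimal, `M, N ∈ SPM_w` strictly
coherent, `m` the rank of the orbit `⟨M,N⟩(w)`, `x ∈ {q, -1}`, and `O = ⟨M,N⟩(u)` any
orbit on `P_{≤ w}`.  Then the operators `T_M, T_N` on the free module `𝔐^O` satisfy the
quadratic relations `T² = (q-1)·T + q·id` and the braid relation of length `m`; these
are the defining relations of the Hecke algebra of the dihedral Coxeter group with
`m(M,N) = m`, so `𝔐^O` is a module over it with the generators acting as `T_M, T_N`. -/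
theorem stmt7 {P : Type*} [PartialOrder P] (hP : IsPircon P)
    (w : P) (hw : ¬ IsMin w) (M N : P → P)
    (hM : IsSPMof w M) (hN : IsSPMof w N)
    (hcoh : StrictlyCoherent M N w)
    (m : ℕ) (hm : IsDihedralIntervalOfRank (orbitMN M N w) m)
    (x : Rq) (hx : x = qq ∨ x = -1)
    (u : P) (hu : u ≤ w) :
    TM M N u x * TM M N u x = (qq - 1) • TM M N u x + qq • (1 : Module.End Rq (OrbMod M N u)) ∧
    TN M N u x * TN M N u x = (qq - 1) • TN M N u x + qq • (1 : Module.End Rq (OrbMod M N u)) ∧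
    altProd (TM M N u x) (TN M N u x) m = altProd (TN M N u x) (TM M N u x) m := by
  obtain ⟨r, hr, hcov⟩ := hP.exists_rank
  have hO : ∀ z ∈ orbitMN M N u, z ≤ w :=
    fun z hz => orbitMN_subset (C := Set.Iic w) hu hM.1 hN.1 hz
  have hMO := hM.isMatchingOn hr hcov hO fun z => left_mem_orbitMN
  have hNO := hN.isMatchingOn hr hcov hO fun z => right_mem_orbitMN
  obtain ⟨hTM, hTM'⟩ := hM.actsAs hO fun z hz => TM_orbitBasis (x := x) hz
  obtain ⟨hTN, hTN'⟩ := hN.actsAs hO fun z hz => TN_orbitBasis (x := x) hz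
  have hx2 : x * x = (qq - 1) * x + qq := by
    rcases hx with rfl | rfl <;> ring
  have hext : ∀ X Y : Module.End Rq (OrbMod M N u), (∀ z ∈ orbitMN M N u,
      X (orbitBasis M N u z) = Y (orbitBasis M N u z)) → X = Y := fun _ _ => end_ext_orbitBasis
  have hM2 := mul_self_eq_of_actsAs hMO hTM hTM' hx2 hext
  have hN2 := mul_self_eq_of_actsAs hNO hTN hTN' hx2 hext
  refine ⟨hM2, hN2, ?_⟩
  obtain ⟨n, hn, h⟩ := exists_braid hM2 hN2 hMO hNO hTM hTN
    ((hP.finite_Iic w).subset hO) ⟨u, Relation.ReflTransGen.refl⟩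
    (fun v hv C => orbitMN_subset_of_mem hMO.invol hNO.invol hv) hext
  refine altProd_comm_of_dvd hn ?_
  rcases h with h | ⟨h, rfl⟩
  · exact (hcoh m hm u hu).1 n h
  · exact (hcoh m hm u hu).2 h

end
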